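/- Let n ≥ 2 and let H(n) be the presented group defined above, with generating set S the images in H(n) of x_1,…,x_n,y_1,…,y_n. Then: (1) for all z, z' ∈ S, [[z,z'],z] = 1 and [[z,z'],z'] = 1; (2) for all z, z', z'' ∈ S, the element [[z,z'],z''] lies in the centre of H(n), [z,z'] = [z',z], [z,z']² = 1, and [[z,z'],z'']² = 1. -/

import Mathlib

/-- The commutator `[g,h] = g⁻¹h⁻¹gh` (paper convention). -/
def gcomm {G : Type*} [Group G] (g h : G) : G := g⁻¹ * h⁻¹ * g * h

/-- The generator index set for `H(n)`: `Sum.inl i` is `x_i`, `Sum.inr j` is `y_j`. -/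
abbrev HGen (n : ℕ) := Fin n ⊕ Fin n

/-- The word `x_i` in the free group. -/
def xw {n : ℕ} (i : Fin n) : FreeGroup (HGen n) := FreeGroup.of (Sum.inl i)

/-- The word `y_j` in the free group. -/
def yw {n : ℕ} (j : Fin n) : FreeGroup (HGen n) := FreeGroup.of (Sum.inr j)

/-- The word `z` in the free group, for a generator `z`. -/
def zw {n : ℕ} (z : HGen n) : FreeGroup (HGen n) := FreeGroup.of z

/-- The relators of the presentation of `H(n)`. -/
def HRels (n : ℕ) : Set (FreeGroup (HGen n)) :=
  {w | ∃ z, w = zw z ^ 2} ∪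
  {w | ∃ i j, w = gcomm (xw i) (xw j)} ∪
  {w | ∃ i j, w = gcomm (yw i) (yw j)} ∪
  {w | ∃ i j, w = gcomm (xw i) (yw j) ^ 2} ∪
  {w | ∃ i j k, w = gcomm (gcomm (yw j) (xw i)) (yw k)} ∪
  {w | ∃ i j z, w = gcomm (gcomm (xw i) (yw j)) (zw z) ^ 2} ∪
  {w | ∃ z₁ z₂ z₃ z₄, w = gcomm (gcomm (gcomm (zw z₁) (zw z₂)) (zw z₃)) (zw z₄)}

/-- The group `H(n)` defined by the presentation. -/
abbrev Hn (n : ℕ) := PresentedGroup (HRels n)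

/-- The image of the generator `x_i` in `H(n)`. -/
def xH {n : ℕ} (i : Fin n) : Hn n := PresentedGroup.of (Sum.inl i)

/-- The image of the generator `y_j` in `H(n)`. -/
def yH {n : ℕ} (j : Fin n) : Hn n := PresentedGroup.of (Sum.inr j)

/-- The subgroup `X = ⟨x_1, …, x_n⟩` of `H(n)`. -/
def XH (n : ℕ) : Subgroup (Hn n) := Subgroup.closure (Set.range (xH (n := n)))

/-- The subgroup `Y = ⟨y_1, …, y_n⟩` of `H(n)`. -/
def YH (n : ℕ) : Subgroup (Hn n) := Subgroup.closure (Set.range (yH (n := n)))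

/-- The image of a generator `z` in `H(n)`. -/
def zH {n : ℕ} (z : HGen n) : Hn n := PresentedGroup.of z

theorem gcomm_eq_one' {G : Type*} [Group G] {g h : G} : gcomm g h = 1 ↔ g * h = h * g := by
  unfold gcomm
  constructor
  · intro e
    have : h * g * (g⁻¹ * h⁻¹ * g * h) = h * g := by rw [e, mul_one]
    rw [← this]; group
  · intro e
    rw [mul_assoc, e]; group

theorem gcomm_inv' {G : Type*} [Group G] (g h : G) : (gcomm g h)⁻¹ = gcomm h g := by
  unfold gcomm; group

theorem map_gcomm' {G K : Type*} [Group G] [Group K] (f : G →* K) (g h : G) :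
    f (gcomm g h) = gcomm (f g) (f h) := by
  simp [gcomm]

theorem gcomm_one_left' {G : Type*} [Group G] (h : G) : gcomm 1 h = 1 := by
  simp [gcomm]

theorem inv_eq_of_sq' {G : Type*} [Group G] {g : G} (h : g ^ 2 = 1) : g⁻¹ = g :=
  inv_eq_of_mul_eq_one_left (by rw [← pow_two, h])

theorem gcomm_left' {G : Type*} [Group G] {a b : G} (ha : a ^ 2 = 1) (hb : b ^ 2 = 1)
    (hc : gcomm a b ^ 2 = 1) : gcomm (gcomm a b) a = 1 := by
  have hc' := inv_eq_of_sq' hc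
  rw [gcomm_inv'] at hc'
  rw [gcomm_eq_one']
  conv_lhs => rw [← hc']
  unfold gcomm
  rw [inv_eq_of_sq' ha, inv_eq_of_sq' hb]
  have : a * a = 1 := by rw [← pow_two, ha]
  simp only [mul_assoc, this]
  simp only [← mul_assoc, this, one_mul, mul_one]

theorem rel_H {n : ℕ} {w : FreeGroup (HGen n)} (h : w ∈ HRels n) :
    PresentedGroup.mk (HRels n) w = 1 := PresentedGroup.one_of_mem h

theorem mk_zw {n : ℕ} (z : HGen n) : PresentedGroup.mk (HRels n) (zw z) = zH z := rfl

theorem zH_sq {n : ℕ} (z : HGen n) : zH z ^ 2 = 1 := by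
  have := rel_H (n := n) (w := zw z ^ 2) (by
    simp only [HRels, Set.mem_union, Set.mem_setOf_eq]; tauto)
  simpa only [map_pow, mk_zw] using this

theorem xx_H {n : ℕ} (i j : Fin n) : gcomm (zH (.inl i)) (zH (.inl j)) = 1 := by
  have := rel_H (n := n) (w := gcomm (xw i) (xw j)) (by
    iterate 5 apply Or.inl
    exact Or.inr ⟨i, j, rfl⟩)
  rwa [map_gcomm'] at this

theorem yy_H {n : ℕ} (i j : Fin n) : gcomm (zH (.inr i)) (zH (.inr j)) = 1 := by
  have := rel_H (n := n) (w := gcomm (yw i) (yw j)) (by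
    iterate 4 apply Or.inl
    exact Or.inr ⟨i, j, rfl⟩)
  rwa [map_gcomm'] at this

theorem xy_H {n : ℕ} (i j : Fin n) : gcomm (zH (.inl i)) (zH (.inr j)) ^ 2 = 1 := by
  have := rel_H (n := n) (w := gcomm (xw i) (yw j) ^ 2) (by
    iterate 3 apply Or.inl
    exact Or.inr ⟨i, j, rfl⟩)
  rwa [map_pow, map_gcomm'] at this

theorem xyz_H {n : ℕ} (i j : Fin n) (z : HGen n) :
    gcomm (gcomm (zH (.inl i)) (zH (.inr j))) (zH z) ^ 2 = 1 := by
  have := rel_H (n := n) (w := gcomm (gcomm (xw i) (yw j)) (zw z) ^ 2) (by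
    iterate 1 apply Or.inl
    exact Or.inr ⟨i, j, z, rfl⟩)
  rwa [map_pow, map_gcomm', map_gcomm'] at this

theorem z4_H {n : ℕ} (a b c d : HGen n) :
    gcomm (gcomm (gcomm (zH a) (zH b)) (zH c)) (zH d) = 1 := by
  have := rel_H (n := n) (w := gcomm (gcomm (gcomm (zw a) (zw b)) (zw c)) (zw d))
    (Or.inr ⟨a, b, c, d, rfl⟩)
  rwa [map_gcomm', map_gcomm', map_gcomm'] at this

theorem comm_sq_H {n : ℕ} (a b : HGen n) : gcomm (zH a) (zH b) ^ 2 = 1 := by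
  rcases a with i | i <;> rcases b with j | j
  · rw [xx_H, one_pow]
  · exact xy_H i j
  · rw [← gcomm_inv', inv_pow, xy_H, inv_one]
  · rw [yy_H, one_pow]

theorem comm_symm_H {n : ℕ} (a b : HGen n) : gcomm (zH a) (zH b) = gcomm (zH b) (zH a) := by
  rw [← gcomm_inv' (zH a), inv_eq_of_sq' (comm_sq_H a b)]

theorem comm3_sq_H {n : ℕ} (a b c : HGen n) :
    gcomm (gcomm (zH a) (zH b)) (zH c) ^ 2 = 1 := by
  rcases a with i | i <;> rcases b with j | j
  · rw [xx_H, gcomm_one_left', one_pow]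
  · exact xyz_H i j c
  · rw [comm_symm_H, xyz_H]
  · rw [yy_H, gcomm_one_left', one_pow]

theorem center_H {n : ℕ} (g : Hn n) (h : ∀ z, gcomm g (zH z) = 1) :
    g ∈ Subgroup.center (Hn n) := by
  have key : (⊤ : Subgroup (Hn n)) ≤ Subgroup.centralizer {g} := by
    rw [← PresentedGroup.closure_range_of, Subgroup.closure_le]
    rintro _ ⟨z, rfl⟩
    rw [SetLike.mem_coe, Subgroup.mem_centralizer_singleton_iff]
    exact (gcomm_eq_one'.1 (h z)).symm
  rw [Subgroup.mem_center_iff]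
  intro k
  exact Subgroup.mem_centralizer_singleton_iff.1 (key (Subgroup.mem_top k))

/-- For generators `z, z', z''` of `H(n)`:
(1) `[[z,z'],z] = 1` and `[[z,z'],z'] = 1`;
(2) `[[z,z'],z'']` is central, `[z,z'] = [z',z]`, `[z,z']² = 1` and `[[z,z'],z'']² = 1`. -/
theorem statement13 (n : ℕ) (hn : 2 ≤ n) :
    (∀ z z' : HGen n,
      gcomm (gcomm (zH z) (zH z')) (zH z) = 1 ∧
      gcomm (gcomm (zH z) (zH z')) (zH z') = 1) ∧
    (∀ z z' z'' : HGen n,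
      gcomm (gcomm (zH z) (zH z')) (zH z'') ∈ Subgroup.center (Hn n) ∧
      gcomm (zH z) (zH z') = gcomm (zH z') (zH z) ∧
      gcomm (zH z) (zH z') ^ 2 = 1 ∧
      gcomm (gcomm (zH z) (zH z')) (zH z'') ^ 2 = 1) := by
  refine ⟨fun z z' => ⟨gcomm_left' (zH_sq z) (zH_sq z') (comm_sq_H z z'), ?_⟩,
    fun z z' z'' => ⟨center_H _ (z4_H z z' z''), comm_symm_H z z', comm_sq_H z z',
      comm3_sq_H z z' z''⟩⟩
  rw [comm_symm_H]
  exact gcomm_left' (zH_sq z') (zH_sq z) (comm_sq_H z' z)
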